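/- arXiv:1205.4486 — 3 statements merged into one kernel-verified Lean document; each statement's English description precedes it below -/
import Mathlib

section
/- Let R be a commutative noetherian ring and M a finitely generated R-module with endomorphism ring E = End_R(M). A prime ideal p of R lies in the support of the cokernel of the natural evaluation map a_M : M ⊗_E M* → R (where M* = Hom_R(M,R)) if and only if the localization M_p is not a generator of the category of finitely generated R_p-modules (i.e., R_p is not a direct summand of a finite direct sum of copies of M_p). -/
open TensorProduct Function

section EvalMachinery

variable (R : Type) [CommRing R] (M : Type) [AddCommGroup M] [Module R M]
variable (X : Type) [AddCommGroup X] [Module R X]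

/-- The relations defining `M ⊗_{End_R M} Hom_R(M, X)` as a quotient of
`M ⊗[R] Hom_R(M, X)`: for `g ∈ End_R(M)` we identify `g m ⊗ f` and `m ⊗ (f ∘ g)`. -/
def endRelations : Submodule R (M ⊗[R] (M →ₗ[R] X)) :=
  Submodule.span R {z | ∃ (g : Module.End R M) (m : M) (f : M →ₗ[R] X),
    z = g m ⊗ₜ[R] f - m ⊗ₜ[R] (f ∘ₗ g)}

/-- The tensor product `M ⊗_{E} Hom_R(M, X)`, where `E = End_R(M)`. -/
abbrev TensorOverEnd := (M ⊗[R] (M →ₗ[R] X)) ⧸ endRelations R M X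

/-- The natural evaluation map `M ⊗_E Hom_R(M, X) → X`, `m ⊗ f ↦ f m`.
For `X = R` this is the map `a_M`. -/
noncomputable def evalMap : TensorOverEnd R M X →ₗ[R] X :=
  Submodule.liftQ _ (TensorProduct.lift LinearMap.applyₗ) (by
    rw [endRelations, Submodule.span_le]
    rintro z ⟨g, m, f, rfl⟩
    simp [SetLike.mem_coe, LinearMap.mem_ker])

/-- The non-generating locus `NG(M)`: the support of the cokernel of
`a_M : M ⊗_E Hom_R(M,R) → R`. -/
noncomputable def NG : Set (PrimeSpectrum R) :=
  Module.support R (R ⧸ LinearMap.range (evalMap R M R))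

end EvalMachinery

theorem apply_mem_range_evalMap (R : Type) [CommRing R] (M : Type) [AddCommGroup M] [Module R M]
    (X : Type) [AddCommGroup X] [Module R X] (f : M →ₗ[R] X) (m : M) :
    f m ∈ LinearMap.range (evalMap R M X) :=
  ⟨Submodule.Quotient.mk (m ⊗ₜ[R] f), by simp [evalMap]⟩

theorem range_evalMap_le_iff (R : Type) [CommRing R] (M : Type) [AddCommGroup M] [Module R M]
    (X : Type) [AddCommGroup X] [Module R X] (N : Submodule R X) :
    LinearMap.range (evalMap R M X) ≤ N ↔ ∀ (f : M →ₗ[R] X) (m : M), f m ∈ N := by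
  refine ⟨fun h f m => h (apply_mem_range_evalMap R M X f m), fun h => ?_⟩
  rintro _ ⟨z, rfl⟩
  obtain ⟨z, rfl⟩ := Submodule.Quotient.mk_surjective _ z
  induction z using TensorProduct.induction_on with
  | zero => simp
  | tmul m f => simpa [evalMap] using h f m
  | add x y hx hy =>
    rw [Submodule.Quotient.mk_add, map_add]
    exact N.add_mem hx hy

theorem mem_NG_iff (R : Type) [CommRing R] (M : Type) [AddCommGroup M] [Module R M]
    (p : PrimeSpectrum R) :
    p ∈ NG R M ↔ ∀ (f : M →ₗ[R] R) (m : M), f m ∈ p.asIdeal := by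
  rw [← range_evalMap_le_iff, NG, Module.mem_support_iff_of_finite, Ideal.annihilator_quotient]

/-- A prime `p` lies in the support of `coker (a_M)` iff `M_p` is not a generator of
`mod R_p`, i.e. iff there is no surjection from a finite direct sum of copies of `M_p`
onto `R_p`. -/
theorem statement0 (R : Type) [CommRing R] [IsNoetherianRing R]
    (M : Type) [AddCommGroup M] [Module R M] [Module.Finite R M]
    (p : PrimeSpectrum R) :
    p ∈ NG R M ↔
      ¬ ∃ (n : ℕ) (f : (Fin n → LocalizedModule p.asIdeal.primeCompl M)
            →ₗ[Localization.AtPrime p.asIdeal] Localization.AtPrime p.asIdeal),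
          Surjective f := by
  rw [mem_NG_iff, iff_not_comm, Iff.comm]
  set S := p.asIdeal.primeCompl
  constructor
  · intro h
    push Not at h
    obtain ⟨φ, m, hm⟩ := h
    let ψ := IsLocalizedModule.mapExtendScalars S (LocalizedModule.mkLinearMap S M)
      (Algebra.linearMap R (Localization.AtPrime p.asIdeal)) (Localization.AtPrime p.asIdeal) φ
    refine ⟨1, ψ ∘ₗ LinearMap.proj 0, ?_⟩
    have hψ : ψ (LocalizedModule.mkLinearMap S M m) = algebraMap R _ (φ m) :=
      IsLocalizedModule.map_apply S _ _ φ m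
    obtain ⟨u, hu⟩ := IsLocalization.map_units (Localization.AtPrime p.asIdeal) (⟨φ m, hm⟩ : S)
    refine fun y => ⟨fun _ => (y * ↑u⁻¹) • LocalizedModule.mkLinearMap S M m, ?_⟩
    simp only [LinearMap.comp_apply, LinearMap.proj_apply, map_smul, hψ, smul_eq_mul]
    rw [show algebraMap R _ (φ m) = (u : Localization.AtPrime p.asIdeal) from hu.symm,
      mul_assoc, Units.inv_mul, mul_one]
  · rintro ⟨n, f, hf⟩ h
    have key (g : LocalizedModule S M →ₗ[Localization.AtPrime p.asIdeal]
        Localization.AtPrime p.asIdeal) (x : LocalizedModule S M) :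
        g x ∈ IsLocalRing.maximalIdeal (Localization.AtPrime p.asIdeal) := by
      have := Module.finitePresentation_of_finite R M
      obtain ⟨φ, s, hφ⟩ := Module.FinitePresentation.exists_lift_of_isLocalizedModule S
        (Algebra.linearMap R (Localization.AtPrime p.asIdeal))
        (g.restrictScalars R ∘ₗ LocalizedModule.mkLinearMap S M)
      obtain ⟨⟨m, t⟩, hx⟩ := IsLocalizedModule.surj S (LocalizedModule.mkLinearMap S M) x
      have hgx : algebraMap R (Localization.AtPrime p.asIdeal) ((s * t : S) : R) * g x =
          algebraMap R _ (φ m) := by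
        have h₁ := LinearMap.congr_fun hφ m
        simp only [LinearMap.comp_apply, Algebra.linearMap_apply, LinearMap.smul_apply,
          LinearMap.coe_restrictScalars, ← hx] at h₁
        rw [h₁, Submonoid.smul_def, Submonoid.smul_def, ← algebraMap_smul
          (Localization.AtPrime p.asIdeal) (t : R) x, map_smul, Algebra.smul_def]
        simp [mul_assoc]
      rw [IsLocalRing.mem_maximalIdeal, mem_nonunits_iff]
      intro hu
      have hv := (IsLocalization.map_units (Localization.AtPrime p.asIdeal) (s * t)).mul hu
      rw [hgx, IsLocalization.AtPrime.isUnit_to_map_iff _ p.asIdeal] at hv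
      exact hv (h φ m)
    obtain ⟨x, hx⟩ := hf 1
    refine (Ideal.ne_top_iff_one _).mp (IsLocalRing.maximalIdeal.isMaximal _).ne_top (?_ :
      (1 : Localization.AtPrime p.asIdeal) ∈ IsLocalRing.maximalIdeal _)
    rw [← hx, ← LinearMap.sum_single_apply _ x, map_sum]
    exact Ideal.sum_mem _ fun i _ => key
      (f ∘ₗ LinearMap.single _ (fun _ : Fin n => LocalizedModule S M) i) (x i)
end

section
/- Let R be a commutative noetherian semilocal ring and E a module-finite R-algebra of finite global dimension. Then the Grothendieck group K_0 of the category of finitely generated E-modules is a finitely generated abelian group. -/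
section GlobalDimension

open Function

/-- `ProjDimLE A n M` says that the `A`-module `M` admits a projective resolution of
length at most `n`. -/
inductive ProjDimLE (A : Type) [Ring A] : ℕ → ModuleCat.{0} A → Prop
  | proj (M : ModuleCat.{0} A) (h : Module.Projective A M) : ProjDimLE A 0 M
  | step (n : ℕ) (M P : ModuleCat.{0} A) (hP : Module.Projective A P)
      (f : P →ₗ[A] M) (hf : Surjective f)
      (h : ProjDimLE A n (ModuleCat.of A (LinearMap.ker f))) : ProjDimLE A (n + 1) M

/-- A ring has finite global dimension if there is a uniform finite bound on the
projective dimension of all (left) modules. -/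
def HasFiniteGlobalDim (A : Type) [Ring A] : Prop :=
  ∃ n : ℕ, ∀ M : ModuleCat.{0} A, ProjDimLE A n M

end GlobalDimension
section K0

open Function

/-- The (bundled) finitely generated modules over a ring `A`. -/
def FGModuleClass (A : Type) [Ring A] : Type 1 :=
  {M : ModuleCat.{0} A // Module.Finite A M}

/-- The subgroup of relations coming from short exact sequences `0 → M → N → P → 0`
of finitely generated modules: `[N] - [M] - [P]`. -/
def K0Relations (A : Type) [Ring A] : AddSubgroup (FreeAbelianGroup (FGModuleClass A)) :=
  AddSubgroup.closure {x | ∃ (M N P : FGModuleClass A)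
    (f : (M.1 : Type) →ₗ[A] (N.1 : Type)) (g : (N.1 : Type) →ₗ[A] (P.1 : Type)),
    Injective f ∧ Surjective g ∧ LinearMap.range f = LinearMap.ker g ∧
    x = FreeAbelianGroup.of N - FreeAbelianGroup.of M - FreeAbelianGroup.of P}

/-- The Grothendieck group `K₀` of the abelian category of finitely generated
`A`-modules: the free abelian group on finitely generated modules modulo the
relations coming from short exact sequences. -/
abbrev K0 (A : Type) [Ring A] : Type 1 :=
  FreeAbelianGroup (FGModuleClass A) ⧸ K0Relations A

end K0

section Radical

variable {R : Type*} [CommRing R]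

theorem isArtinian_of_jacobson_smul_eq_zero [Finite (MaximalSpectrum R)]
    (M : Type*) [AddCommGroup M] [Module R M] [Module.Finite R M]
    (h : ∀ a ∈ Ring.jacobson R, ∀ x : M, a • x = 0) : IsArtinian R M := by
  obtain ⟨n, f, hf⟩ := Module.Finite.exists_fin' R M
  have (m : MaximalSpectrum R) : IsArtinian R (R ⧸ m.asIdeal) :=
    have : IsSimpleModule R (R ⧸ m.asIdeal) :=
      isSimpleModule_iff_isCoatom.mpr (Ideal.isMaximal_def.mp m.isMaximal)
    inferInstance
  let φ : R →ₗ[R] (m : MaximalSpectrum R) → R ⧸ m.asIdeal :=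
    LinearMap.pi fun m ↦ m.asIdeal.mkQ
  let ψ : (Fin n → R) →ₗ[R] Fin n → (m : MaximalSpectrum R) → R ⧸ m.asIdeal :=
    LinearMap.pi fun i ↦ φ ∘ₗ LinearMap.proj i
  have hker : LinearMap.ker ψ ≤ LinearMap.ker f := fun v hv ↦ by
    have hv' (i : Fin n) : v i ∈ Ring.jacobson R := by
      rw [Ring.jacobson_eq_sInf_isMaximal, Submodule.mem_sInf]
      intro I hI
      have := congrFun (congrFun (LinearMap.mem_ker.mp hv) i) ⟨I, hI⟩
      exact (Submodule.Quotient.mk_eq_zero I).mp this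
    rw [LinearMap.mem_ker, LinearMap.pi_apply_eq_sum_univ]
    exact Finset.sum_eq_zero fun i _ ↦ h _ (hv' i) _
  have : IsArtinian R ((Fin n → R) ⧸ LinearMap.ker ψ) :=
    isArtinian_of_linearEquiv ψ.quotKerEquivRange.symm
  refine isArtinian_of_surjective _ ((LinearMap.ker ψ).liftQ f hker) ?_
  rw [← LinearMap.range_eq_top, Submodule.range_liftQ, LinearMap.range_eq_top.mpr hf]

variable {E : Type*} [Ring E] [Algebra R E]

theorem jacobson_smul_mem_jacobson [Module.Finite R E] {a : R} (ha : a ∈ Ring.jacobson R) (x : E) :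
    a • x ∈ Module.jacobson E E := by
  refine Submodule.mem_sInf.mpr fun N hN ↦ ?_
  have : IsSimpleModule E (E ⧸ N) := isSimpleModule_iff_isCoatom.mpr hN
  have : Nontrivial (E ⧸ N) := IsSimpleModule.nontrivial E _
  have : Module.Finite R (E ⧸ N) := .trans E _
  let μ : (E ⧸ N) →ₗ[E] (E ⧸ N) := algebraMap R (Module.End E (E ⧸ N)) a
  have hμ (y : E ⧸ N) : μ y = a • y := rfl
  obtain hb | h0 := μ.bijective_or_eq_zero
  · have hlt := Submodule.jacobson_smul_lt_top (R := R) (M := E ⧸ N) ⊤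
    refine absurd (top_le_iff.mp fun y _ ↦ ?_) hlt.ne
    obtain ⟨z, rfl⟩ := hb.2 y
    exact Submodule.smul_mem_smul ha trivial
  · rw [← Submodule.Quotient.mk_eq_zero, Submodule.Quotient.mk_smul, ← hμ, h0,
      LinearMap.zero_apply]

theorem isSemisimpleModule_quotient_jacobson [Finite (MaximalSpectrum R)] [Module.Finite R E] :
    IsSemisimpleModule E (E ⧸ Module.jacobson E E) := by
  have : Module.Finite R (E ⧸ Module.jacobson E E) := .trans E _
  have : IsArtinian R (E ⧸ Module.jacobson E E) := by
    refine isArtinian_of_jacobson_smul_eq_zero _ fun a ha x ↦ ?_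
    obtain ⟨x, rfl⟩ := Submodule.Quotient.mk_surjective _ x
    rw [← Submodule.Quotient.mk_smul, Submodule.Quotient.mk_eq_zero]
    exact jacobson_smul_mem_jacobson ha x
  have : IsArtinian E (E ⧸ Module.jacobson E E) := isArtinian_of_tower R this
  exact (IsArtinian.isSemisimpleModule_iff_jacobson _ _).mpr (Module.jacobson_quotient_jacobson E E)

end Radical

section RadicalQuotient

variable {E : Type*} [Ring E] {M N : Type*} [AddCommGroup M] [Module E M]
  [AddCommGroup N] [Module E N]

/-- The map induced on quotients by the radical. -/
def LinearMap.mapQJacobson (f : M →ₗ[E] N) :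
    M ⧸ Module.jacobson E M →ₗ[E] N ⧸ Module.jacobson E N :=
  (Module.jacobson E M).mapQ _ f (Module.le_comap_jacobson f)

@[simp] theorem LinearMap.mapQJacobson_mk (f : M →ₗ[E] N) (x : M) :
    f.mapQJacobson (Submodule.Quotient.mk x) = Submodule.Quotient.mk (f x) := rfl

theorem Submodule.eq_top_of_sup_jacobson_eq_top [Module.Finite E M] {L : Submodule E M}
    (h : L ⊔ Module.jacobson E M = ⊤) : L = ⊤ := by
  by_contra hL
  obtain ⟨C, hC, hLC⟩ := (eq_top_or_exists_le_coatom L).resolve_left hL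
  exact hC.1 (top_le_iff.mp (h ▸ sup_le hLC (sInf_le hC)))

theorem LinearMap.surjective_of_mapQJacobson [Module.Finite E N] (f : M →ₗ[E] N)
    (h : Function.Surjective f.mapQJacobson) : Function.Surjective f := by
  rw [← LinearMap.range_eq_top]
  refine Submodule.eq_top_of_sup_jacobson_eq_top (eq_top_iff.mpr fun y _ ↦ ?_)
  obtain ⟨x, hx⟩ := h (Submodule.Quotient.mk y)
  obtain ⟨x, rfl⟩ := Submodule.Quotient.mk_surjective _ x
  rw [LinearMap.mapQJacobson_mk, eq_comm, Submodule.Quotient.eq] at hx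
  exact Submodule.mem_sup.mpr ⟨f x, ⟨x, rfl⟩, _, hx, by abel⟩

theorem exists_surjective_of_quotient_jacobson [Module.Projective E M] [Module.Finite E N]
    (g : M ⧸ Module.jacobson E M →ₗ[E] N ⧸ Module.jacobson E N) (hg : Function.Surjective g) :
    ∃ f : M →ₗ[E] N, Function.Surjective f := by
  obtain ⟨f, hf⟩ := Module.projective_lifting_property (Module.jacobson E N).mkQ
    (g ∘ₗ (Module.jacobson E M).mkQ) (Submodule.mkQ_surjective _)
  refine ⟨f, f.surjective_of_mapQJacobson ?_⟩
  have : f.mapQJacobson = g := by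
    ext x
    exact LinearMap.congr_fun hf x
  rwa [this]

theorem isSemisimpleModule_quotient_jacobson_of_finite
    [IsSemisimpleModule E (E ⧸ Module.jacobson E E)] (M : Type*) [AddCommGroup M] [Module E M]
    [Module.Finite E M] : IsSemisimpleModule E (M ⧸ Module.jacobson E M) := by
  obtain ⟨n, f, hf⟩ := Module.Finite.exists_fin' E M
  let F : (Fin n → E ⧸ Module.jacobson E E) →ₗ[E] M ⧸ Module.jacobson E M :=
    ∑ i, (f ∘ₗ LinearMap.single E (fun _ ↦ E) i).mapQJacobson ∘ₗ LinearMap.proj i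
  have hF : Function.Surjective F := fun y ↦ by
    obtain ⟨y, rfl⟩ := Submodule.Quotient.mk_surjective _ y
    obtain ⟨v, rfl⟩ := hf y
    refine ⟨fun i ↦ Submodule.Quotient.mk (v i), ?_⟩
    conv_rhs => rw [← Finset.univ_sum_single v, map_sum, ← Submodule.mkQ_apply, map_sum]
    simp only [F, LinearMap.sum_apply]
    rfl
  have : IsSemisimpleModule E (LinearMap.range F) := .range F
  exact .congr (LinearEquiv.ofTop _ (LinearMap.range_eq_top.mpr hF)).symm

theorem exists_linearEquiv_of_isSimpleModule {k : ℕ}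
    {S : Fin k → Submodule E (E ⧸ Module.jacobson E E)} [∀ i, IsSimpleModule E (S i)]
    (e : (E ⧸ Module.jacobson E E) ≃ₗ[E] Π₀ i, S i) (T : Type*) [AddCommGroup T] [Module E T]
    [IsSimpleModule E T] : ∃ i, Nonempty (T ≃ₗ[E] S i) := by
  have := IsSimpleModule.nontrivial E T
  obtain ⟨t, ht⟩ := exists_ne (0 : T)
  let f := LinearMap.toSpanSingleton E T t
  have hf : Module.jacobson E E ≤ LinearMap.ker f := by
    have := Module.le_comap_jacobson f
    rwa [IsSemisimpleModule.jacobson_eq_bot E T] at this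
  let g : (Π₀ i, S i) →ₗ[E] T := (Module.jacobson E E).liftQ f hf ∘ₗ e.symm.toLinearMap
  have hg : g ≠ 0 := fun h ↦ ht <| by
    have h1 : g (e (Submodule.Quotient.mk 1)) = t := by
      rw [LinearMap.comp_apply, LinearEquiv.coe_coe, e.symm_apply_apply, Submodule.liftQ_apply,
        LinearMap.toSpanSingleton_apply, one_smul]
    rw [← h1, h, LinearMap.zero_apply]
  obtain ⟨i, hi⟩ : ∃ i, g ∘ₗ DFinsupp.lsingle i ≠ 0 := by
    by_contra! h
    exact hg (DFinsupp.lhom_ext' fun i ↦ by rw [h i, LinearMap.zero_comp])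
  exact ⟨i, ⟨(LinearEquiv.ofBijective _
    ((LinearMap.bijective_or_eq_zero _).resolve_right hi)).symm⟩⟩

theorem length_ker_quotient_jacobson_lt [IsSemisimpleModule E (E ⧸ Module.jacobson E E)]
    [Module.Finite E M] [Module.Projective E N] [Module.Finite E N] [Nontrivial N]
    (f : M →ₗ[E] N) (hf : Function.Surjective f) :
    Module.length E (LinearMap.ker f ⧸ Module.jacobson E (LinearMap.ker f)) <
      Module.length E (M ⧸ Module.jacobson E M) := by
  obtain ⟨s, hs⟩ := Module.projective_lifting_property f LinearMap.id hf
  have hs' (x : N) : f (s x) = x := LinearMap.congr_fun hs x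
  let r : M →ₗ[E] LinearMap.ker f :=
    (LinearMap.id - s ∘ₗ f).codRestrict _ fun x ↦ by simp [hs']
  let F := r.mapQJacobson.prod f.mapQJacobson
  have hF : Function.Surjective F := by
    rintro ⟨x, y⟩
    obtain ⟨x, rfl⟩ := Submodule.Quotient.mk_surjective _ x
    obtain ⟨y, rfl⟩ := Submodule.Quotient.mk_surjective _ y
    refine ⟨Submodule.Quotient.mk (x + s y), Prod.ext ?_ ?_⟩
    · suffices r (x + s y) = x from congrArg Submodule.Quotient.mk this
      ext
      simp [r, hs']
    · suffices f (x + s y) = y from congrArg Submodule.Quotient.mk this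
      simp [hs']
  have hle := Module.length_le_of_surjective F hF
  rw [Module.length_prod] at hle
  have := isSemisimpleModule_quotient_jacobson_of_finite (E := E) M
  have : IsArtinian E (M ⧸ Module.jacobson E M) := inferInstance
  have : IsNoetherian E (M ⧸ Module.jacobson E M) := inferInstance
  have hfin := Module.length_ne_top (R := E) (M := M ⧸ Module.jacobson E M)
  have : Nontrivial (N ⧸ Module.jacobson E N) :=
    Submodule.Quotient.nontrivial_iff.mpr (Module.jacobson_lt_top E N).ne
  have hpos := Module.length_pos (R := E) (M := N ⧸ Module.jacobson E N)
  refine lt_of_lt_of_le ?_ hle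
  rw [add_comm]
  exact ENat.lt_add_left (ne_top_of_le_ne_top hfin (le_self_add.trans hle)) hpos

theorem exists_leftInverse_ker_subtype [Module.Projective E N] (f : M →ₗ[E] N)
    (hf : Function.Surjective f) :
    ∃ r : M →ₗ[E] LinearMap.ker f, r ∘ₗ (LinearMap.ker f).subtype = LinearMap.id := by
  obtain ⟨s, hs⟩ := Module.projective_lifting_property f LinearMap.id hf
  have hs' (x : N) : f (s x) = x := LinearMap.congr_fun hs x
  refine ⟨(LinearMap.id - s ∘ₗ f).codRestrict _ fun x ↦ by simp [hs'], ?_⟩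
  ext x
  simp

theorem finite_ker_of_surjective [Module.Finite E M] [Module.Projective E N]
    (f : M →ₗ[E] N) (hf : Function.Surjective f) : Module.Finite E (LinearMap.ker f) :=
  have ⟨r, hr⟩ := exists_leftInverse_ker_subtype f hf
  .of_surjective r fun x ↦ ⟨x, LinearMap.congr_fun hr x⟩

theorem projective_ker_of_surjective [Module.Projective E M] [Module.Projective E N]
    (f : M →ₗ[E] N) (hf : Function.Surjective f) : Module.Projective E (LinearMap.ker f) :=
  have ⟨r, hr⟩ := exists_leftInverse_ker_subtype f hf
  .of_split (LinearMap.ker f).subtype r hr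

end RadicalQuotient

theorem exists_surjective_pi {E : Type*} [Ring E] {k m n : ℕ} {T : Fin m → Type*}
    {U : Fin n → Type*} [∀ i, AddCommGroup (T i)] [∀ i, Module E (T i)]
    [∀ i, AddCommGroup (U i)] [∀ i, Module E (U i)]
    {σ : Fin m → Fin k} {τ : Fin n → Fin k}
    (h : ∀ i j, σ i = τ j → Nonempty (T i ≃ₗ[E] U j))
    (hc : ∀ l, Nat.card {j // τ j = l} ≤ Nat.card {i // σ i = l}) :
    ∃ f : (∀ i, T i) →ₗ[E] ∀ j, U j, Function.Surjective f := by
  have hemb (l : Fin k) : Nonempty ({j // τ j = l} ↪ {i // σ i = l}) := by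
    simp only [Nat.card_eq_fintype_card] at hc
    exact Function.Embedding.nonempty_of_card_le (hc l)
  let ι (j : Fin n) : {i // σ i = τ j} := (hemb (τ j)).some ⟨j, rfl⟩
  have hι : Function.Injective fun j ↦ (ι j).1 := fun j j' hjj' ↦ by
    have hτ : τ j = τ j' := by rw [← (ι j).2, ← (ι j').2]; exact congrArg σ hjj'
    have aux (l : Fin k) (a : {j // τ j = l}) (ha : τ a.1 = l) :
        ((hemb (τ a.1)).some ⟨a.1, rfl⟩).1 = ((hemb l).some a).1 := by
      obtain ⟨a, rfl⟩ := a
      rfl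
    have h1 := aux (τ j') ⟨j, hτ⟩ hτ
    have h2 : (hemb (τ j')).some ⟨j, hτ⟩ = (hemb (τ j')).some ⟨j', rfl⟩ :=
      Subtype.ext (h1.symm.trans hjj')
    exact congrArg Subtype.val ((hemb (τ j')).some.injective h2)
  let e (j : Fin n) : T (ι j).1 ≃ₗ[E] U j := (h _ j (ι j).2).some
  refine ⟨LinearMap.pi fun j ↦ (e j).toLinearMap ∘ₗ LinearMap.proj (ι j).1, fun y ↦
    ⟨∑ j, Pi.single (ι j).1 ((e j).symm (y j)), funext fun j ↦ ?_⟩⟩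
  have : (∑ j', Pi.single (ι j').1 ((e j').symm (y j')) : ∀ i, T i) (ι j).1 =
      (e j).symm (y j) := by
    rw [Finset.sum_apply, Finset.sum_eq_single j, Pi.single_eq_same]
    · exact fun j' _ hne ↦ Pi.single_eq_of_ne (fun heq ↦ hne (hι heq.symm)) _
    · simp
  exact (congrArg (e j) this).trans ((e j).apply_symm_apply _)

section K0Lemmas

open CategoryTheory

variable {E : Type} [Ring E]

/-- The class in `K₀` of a finitely generated module. -/
def K0.mk (M : Type) [AddCommGroup M] [Module E M] [h : Module.Finite E M] : K0 E :=
  QuotientAddGroup.mk (FreeAbelianGroup.of ⟨ModuleCat.of E M, h⟩)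

theorem K0.mk_eq_add {M N : Type} [AddCommGroup M] [Module E M] [Module.Finite E M]
    [AddCommGroup N] [Module E N] [Module.Finite E N] (f : M →ₗ[E] N)
    (hf : Function.Surjective f) [Module.Finite E (LinearMap.ker f)] :
    (K0.mk M : K0 E) = K0.mk (LinearMap.ker f) + K0.mk N := by
  rw [← sub_eq_zero, ← sub_sub]
  refine (QuotientAddGroup.eq_zero_iff _).mpr (AddSubgroup.subset_closure ?_)
  exact ⟨⟨ModuleCat.of E (LinearMap.ker f), ‹_›⟩, ⟨ModuleCat.of E M, ‹_›⟩, ⟨ModuleCat.of E N, ‹_›⟩,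
    (LinearMap.ker f).subtype, f, Subtype.val_injective, hf, Submodule.range_subtype _, rfl⟩

theorem K0.mk_eq_zero (M : Type) [AddCommGroup M] [Module E M] [Module.Finite E M]
    [Subsingleton M] : (K0.mk M : K0 E) = 0 := by
  have : (K0.mk M - K0.mk M - K0.mk M : K0 E) = 0 :=
    (QuotientAddGroup.eq_zero_iff _).mpr <| AddSubgroup.subset_closure
      ⟨⟨ModuleCat.of E M, ‹_›⟩, ⟨ModuleCat.of E M, ‹_›⟩, ⟨ModuleCat.of E M, ‹_›⟩,
        (LinearMap.id : M →ₗ[E] M), (LinearMap.id : M →ₗ[E] M), Function.injective_id,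
        Function.surjective_id, Subsingleton.elim (α := Submodule E M) _ _, rfl⟩
  simpa using this

theorem K0.eq_top_of_mk_mem {H : AddSubgroup (K0 E)}
    (h : ∀ (M : Type) [AddCommGroup M] [Module E M] [Module.Finite E M], K0.mk M ∈ H) :
    H = ⊤ := by
  refine eq_top_iff.mpr fun x _ ↦ ?_
  obtain ⟨x, rfl⟩ := QuotientAddGroup.mk_surjective x
  induction x using FreeAbelianGroup.induction_on with
  | zero => exact H.zero_mem
  | of M => have := M.2; exact h M.1
  | neg M _ => have := M.2; exact H.neg_mem (h M.1)
  | add x y hx hy => exact H.add_mem (hx trivial) (hy trivial)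

theorem ProjDimLE.hasProjectiveDimensionLT {n : ℕ} {M : ModuleCat.{0} E} (h : ProjDimLE E n M) :
    HasProjectiveDimensionLT M (n + 1) := by
  induction h with
  | proj M h =>
    have : Projective M := (IsProjective.iff_projective M).mp h
    infer_instance
  | step n M P hP f hf _ ih =>
    have : Projective P := (IsProjective.iff_projective P).mp hP
    exact ((LinearMap.shortExact_shortComplexKer hf).hasProjectiveDimensionLT_X₃_iff n this).mpr ih

theorem K0.mk_mem_of_hasProjectiveDimensionLT [IsNoetherianRing E] {H : AddSubgroup (K0 E)}
    (h : ∀ (P : Type) [AddCommGroup P] [Module E P] [Module.Finite E P] [Module.Projective E P],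
      K0.mk P ∈ H) (n : ℕ) (M : Type) [AddCommGroup M] [Module E M] [Module.Finite E M]
    (hM : HasProjectiveDimensionLT (ModuleCat.of E M) (n + 1)) : K0.mk M ∈ H := by
  induction n generalizing M with
  | zero =>
    have := (IsProjective.iff_projective M).mpr
      (projective_iff_hasProjectiveDimensionLT_one.mpr hM)
    exact h M
  | succ n ih =>
    obtain ⟨k, f, hf⟩ := Module.Finite.exists_fin' E M
    have hP : Projective (ModuleCat.of E (Fin k → E)) :=
      (IsProjective.iff_projective _).mp inferInstance
    have hker := ih (LinearMap.ker f)
      (((LinearMap.shortExact_shortComplexKer hf).hasProjectiveDimensionLT_X₃_iff n hP).mp hM)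
    have := K0.mk_eq_add f hf
    rw [eq_sub_of_add_eq' this.symm]
    exact H.sub_mem (h _) hker

end K0Lemmas

theorem exists_multiplicity (E : Type) [Ring E] [IsSemisimpleModule E (E ⧸ Module.jacobson E E)] :
    ∃ (k : ℕ) (c : FGModuleClass E → Fin k → ℕ), ∀ M N : FGModuleClass E, c N ≤ c M →
      ∃ g : M.1 ⧸ Module.jacobson E M.1 →ₗ[E] N.1 ⧸ Module.jacobson E N.1,
        Function.Surjective g := by
  obtain ⟨k, S, e, hS⟩ :=
    IsSemisimpleModule.exists_linearEquiv_fin_dfinsupp E (E ⧸ Module.jacobson E E)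
  have key (M : FGModuleClass E) : ∃ (n : ℕ)
      (T : Fin n → Submodule E (M.1 ⧸ Module.jacobson E M.1)) (σ : Fin n → Fin k),
      Nonempty ((M.1 ⧸ Module.jacobson E M.1) ≃ₗ[E] ∀ i, T i) ∧
        ∀ i, Nonempty (T i ≃ₗ[E] S (σ i)) := by
    have := M.2
    have := isSemisimpleModule_quotient_jacobson_of_finite (E := E) M.1
    obtain ⟨n, T, e', hT⟩ :=
      IsSemisimpleModule.exists_linearEquiv_fin_dfinsupp E (M.1 ⧸ Module.jacobson E M.1)
    choose σ hσ using fun i ↦ exists_linearEquiv_of_isSimpleModule e (T i)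
    exact ⟨n, T, σ, ⟨e'.trans DFinsupp.linearEquivFunOnFintype⟩, hσ⟩
  choose n T σ hM hσ using key
  refine ⟨k, fun M l ↦ Nat.card {i // σ M i = l}, fun M N hle ↦ ?_⟩
  obtain ⟨f, hf⟩ := exists_surjective_pi (E := E) (T := fun i ↦ T M i) (U := fun i ↦ T N i)
    (σ := σ M) (τ := σ N)
    (fun i j hij ↦ ⟨(hσ M i).some.trans (hij ▸ (hσ N j).some.symm)⟩) hle
  exact ⟨(hM N).some.symm.toLinearMap ∘ₗ f ∘ₗ (hM M).some.toLinearMap,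
    (hM N).some.symm.surjective.comp (hf.comp (hM M).some.surjective)⟩

/-- If `E` is semisimple modulo its radical, finitely many classes generate the
classes of all finitely generated projective modules. -/
theorem exists_finite_closure_projective (E : Type) [Ring E]
    [IsSemisimpleModule E (E ⧸ Module.jacobson E E)] :
    ∃ F : Set (K0 E), F.Finite ∧ ∀ (P : Type) [AddCommGroup P] [Module E P] [Module.Finite E P]
      [Module.Projective E P], K0.mk P ∈ AddSubgroup.closure F := by
  obtain ⟨k, c, hc⟩ := exists_multiplicity E
  let Φ : Set (FGModuleClass E) := {M | Module.Projective E M.1 ∧ Nontrivial M.1}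
  let A : Set (Fin k → ℕ) := {v | Minimal (· ∈ c '' Φ) v}
  have hA : A.Finite := WellQuasiOrderedLE.finite_of_isAntichain (setOfPred_minimal_antichain _)
  have hAΦ : ∀ v : A, ∃ Q ∈ Φ, c Q = v := fun v ↦ v.2.1
  choose Q hQΦ hQ using hAΦ
  have := hA.to_subtype
  refine ⟨Set.range fun v ↦ (QuotientAddGroup.mk (FreeAbelianGroup.of (Q v)) : K0 E),
    Set.finite_range _, ?_⟩
  suffices h : ∀ (l : ℕ∞) (P : Type) [AddCommGroup P] [Module E P] [Module.Finite E P]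
      [Module.Projective E P], Module.length E (P ⧸ Module.jacobson E P) = l →
      K0.mk P ∈ AddSubgroup.closure (Set.range fun v ↦
        (QuotientAddGroup.mk (FreeAbelianGroup.of (Q v)) : K0 E)) from fun P ↦ h _ P rfl
  intro l
  induction l using WellFoundedLT.induction with
  | ind l ih =>
  rintro P _ _ _ _ rfl
  cases subsingleton_or_nontrivial P with
  | inl _ => exact K0.mk_eq_zero (E := E) P ▸ zero_mem _
  | inr _ =>
  let P' : FGModuleClass E := ⟨ModuleCat.of E P, ‹_›⟩
  obtain ⟨v, hvP, hv⟩ := exists_minimal_le_of_wellFoundedLT (· ∈ c '' Φ) (c P')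
    ⟨P', ⟨‹_›, ‹_›⟩, rfl⟩
  let w : A := ⟨v, hv⟩
  have := (Q w).2
  have := (hQΦ w).1
  have := (hQΦ w).2
  obtain ⟨g, hg⟩ := hc P' (Q w) ((hQ w).trans_le hvP)
  obtain ⟨f, hf⟩ := exists_surjective_of_quotient_jacobson (M := P) g hg
  have := projective_ker_of_surjective f hf
  have := finite_ker_of_surjective f hf
  rw [K0.mk_eq_add f hf]
  exact add_mem (ih _ (length_ker_quotient_jacobson_lt f hf) _ rfl)
    (AddSubgroup.subset_closure ⟨w, rfl⟩)

/-- Let `R` be a commutative noetherian semilocal ring and `E` a module-finite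
`R`-algebra of finite global dimension. Then the Grothendieck group `K₀(mod E)` is a
finitely generated abelian group. -/
theorem statement6 (R : Type) [CommRing R] [IsNoetherianRing R]
    (hsemilocal : {I : Ideal R | I.IsMaximal}.Finite)
    (E : Type) [Ring E] [Algebra R E] [Module.Finite R E]
    (hgl : HasFiniteGlobalDim E) :
    AddGroup.FG (K0 E) := by
  have := hsemilocal.to_subtype
  have : Finite (MaximalSpectrum R) := (MaximalSpectrum.equivSubtype R).finite_iff.mpr this
  have := isSemisimpleModule_quotient_jacobson (R := R) (E := E)
  have : IsNoetherianRing E := .of_finite R E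
  obtain ⟨n, hn⟩ := hgl
  obtain ⟨F, hF, h⟩ := exists_finite_closure_projective E
  refine (AddGroup.fg_iff).mpr ⟨F, K0.eq_top_of_mk_mem fun M _ _ _ ↦ ?_, hF⟩
  exact K0.mk_mem_of_hasProjectiveDimensionLT h n M (hn (ModuleCat.of E M)).hasProjectiveDimensionLT
end

section
/- Let R be a commutative noetherian ring, M a finitely generated R-module with E = End_R(M), and let C_M be the Serre subcategory of finitely generated R-modules supported on NG(M) = Supp(coker a_M). Then for any finitely generated E-module X and any prime p of R not in NG(M), one has Ext^1_{E}(M*, X)_p = 0; consequently Ext^1_E(M*,X) lies in C_M, where M* = Hom_R(M,R). -/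
open TensorProduct Function

section DualModule

variable (R : Type) [CommRing R] (M : Type) [AddCommGroup M] [Module R M]
variable (X : Type) [AddCommGroup X] [Module R X]

/-- Precomposition, as a ring homomorphism `(End_R M)ᵐᵒᵖ →+* End_R (Hom_R(M,X))`. -/
noncomputable def precompHom : (Module.End R M)ᵐᵒᵖ →+* Module.End R (M →ₗ[R] X) where
  toFun g := LinearMap.lcomp R X g.unop
  map_one' := by ext φ m; simp
  map_mul' a b := by ext φ m; simp
  map_zero' := by ext φ m; simp
  map_add' a b := by ext φ m; simp

/-- The right `End_R(M)`-module structure (i.e. left module structure over the opposite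
ring) on `Hom_R(M, X)` given by precomposition. -/
noncomputable def dualModule : Module (Module.End R M)ᵐᵒᵖ (M →ₗ[R] X) :=
  Module.compHom _ (precompHom R M X)

end DualModule

section Ext1

variable (S : Type) [Ring S] (A : Type) [AddCommGroup A] [Module S A]
variable (B : Type) [AddCommGroup B] [Module S B]
variable (R : Type) [CommRing R] [Module R B] [SMulCommClass S R B]

/-- The canonical presentation of the `S`-module `A` by the free module on `A`. -/
noncomputable def presentation : (A →₀ S) →ₗ[S] A :=
  Finsupp.linearCombination S (id : A → A)

/-- Restriction of homomorphisms along the inclusion of the syzygy module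
`ker ((A →₀ S) → A)`. -/
noncomputable def restrictToSyzygy :
    ((A →₀ S) →ₗ[S] B) →ₗ[R] ((LinearMap.ker (presentation S A)) →ₗ[S] B) where
  toFun φ := φ ∘ₗ (LinearMap.ker (presentation S A)).subtype
  map_add' := by intros; rfl
  map_smul' := by intros; rfl

/-- `Ext¹_S(A, B)`, computed from the canonical free presentation of `A`, with its
`R`-module structure coming from the central action of `R` on `B`. -/
noncomputable abbrev Ext1 : Type :=
  ((LinearMap.ker (presentation S A)) →ₗ[S] B) ⧸
    LinearMap.range (restrictToSyzygy S A B R)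

end Ext1

section Ext1Annihilator

variable {S : Type} [Ring S] {A : Type} [AddCommGroup A] [Module S A]
variable {B : Type} [AddCommGroup B] [Module S B]
variable {R : Type} [CommRing R] [Module R B] [SMulCommClass S R B]

/-- If multiplication by a central element `c` on `A` factors through the canonical
presentation, then a scalar `r` acting on `B` as `c` annihilates `Ext¹_S(A, B)`. -/
theorem smul_Ext1_eq_zero {r : R} {c : S} (hc : ∀ x : S, c * x = x * c)
    (hrc : ∀ b : B, r • b = c • b) (σ : A →ₗ[S] (A →₀ S))
    (hσ : ∀ a, presentation S A (σ a) = c • a) (q : Ext1 S A B R) : r • q = 0 := by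
  obtain ⟨φ, rfl⟩ := Submodule.Quotient.mk_surjective _ q
  let C : (A →₀ S) →ₗ[S] (A →₀ S) :=
    { toFun := fun x => c • x
      map_add' := smul_add c
      map_smul' := fun x y => by simp [smul_smul, hc x] }
  have hC : ∀ x, (C - σ ∘ₗ presentation S A) x ∈ LinearMap.ker (presentation S A) := by
    intro x
    simp [C, hσ]
  rw [← Submodule.Quotient.mk_smul, Submodule.Quotient.mk_eq_zero]
  refine ⟨φ ∘ₗ (C - σ ∘ₗ presentation S A).codRestrict _ hC, ?_⟩
  ext ⟨x, hx⟩
  have key : (C - σ ∘ₗ presentation S A).codRestrict _ hC x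
      = c • (⟨x, hx⟩ : LinearMap.ker (presentation S A)) := by
    apply Subtype.ext
    simp [C, LinearMap.mem_ker.mp hx]
  change φ ((C - σ ∘ₗ presentation S A).codRestrict _ hC x) = r • φ ⟨x, hx⟩
  rw [key, map_smul, hrc]

end Ext1Annihilator

/-- Multiplication on `Hom_R(M, R)` by an element of the trace ideal of `M` factors through
the canonical presentation over `(End_R M)ᵐᵒᵖ`. -/
theorem exists_presentation_lift (R : Type) [CommRing R]
    (M : Type) [AddCommGroup M] [Module R M] (t : M ⊗[R] (M →ₗ[R] R)) :
    letI := dualModule R M R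
    ∃ σ : (M →ₗ[R] R) →ₗ[(Module.End R M)ᵐᵒᵖ] ((M →ₗ[R] R) →₀ (Module.End R M)ᵐᵒᵖ),
      ∀ g, presentation (Module.End R M)ᵐᵒᵖ (M →ₗ[R] R) (σ g)
        = (TensorProduct.lift LinearMap.applyₗ t : R) • g := by
  letI := dualModule R M R
  induction t using TensorProduct.induction_on with
  | zero => exact ⟨0, fun g => by simp⟩
  | tmul m f =>
    let τ : (M →ₗ[R] R) →ₗ[(Module.End R M)ᵐᵒᵖ] (Module.End R M)ᵐᵒᵖ :=
      { toFun := fun g => MulOpposite.op (g.smulRight m)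
        map_add' := fun g h => by
          rw [← MulOpposite.op_add]
          congr 1
          ext x
          simp [add_smul]
        map_smul' := fun e g => rfl }
    refine ⟨Finsupp.lsingle f ∘ₗ τ, fun g => ?_⟩
    have key : presentation (Module.End R M)ᵐᵒᵖ (M →ₗ[R] R) ((Finsupp.lsingle f ∘ₗ τ) g)
        = τ g • f := by
      simp [presentation]
    rw [key]
    ext x
    change f (g x • m) = f m • g x
    simp [mul_comm]
  | add a b ha hb =>
    obtain ⟨σ, hσ⟩ := ha
    obtain ⟨ρ, hρ⟩ := hb
    exact ⟨σ + ρ, fun g => by simp [hσ, hρ, add_smul]⟩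

/-- Let `R` be noetherian, `M` a finitely generated `R`-module, `E = End_R(M)` and
`X` a finitely generated (right) `E`-module whose `R`-action comes from the central
embedding `R → E`.  Then for every prime `p ∉ NG(M)` the localization
`Ext¹_E(M^*, X)_p` vanishes; consequently `Ext¹_E(M^*, X)` is supported on `NG(M)`,
i.e. it lies in the Serre subcategory `C_M`. -/
theorem statement7 (R : Type) [CommRing R] [IsNoetherianRing R]
    (M : Type) [AddCommGroup M] [Module R M] [Module.Finite R M]
    (X : Type) [AddCommGroup X] [Module R X]
    [Module (Module.End R M)ᵐᵒᵖ X] [SMulCommClass (Module.End R M)ᵐᵒᵖ R X]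
    [Module.Finite (Module.End R M)ᵐᵒᵖ X]
    (hcentral : ∀ (r : R) (x : X),
      r • x = (MulOpposite.op (r • (1 : Module.End R M))) • x) :
    letI := dualModule R M R
    (∀ p : PrimeSpectrum R, p ∉ NG R M →
      Subsingleton (LocalizedModule p.asIdeal.primeCompl
        (Ext1 (Module.End R M)ᵐᵒᵖ (M →ₗ[R] R) X R))) ∧
    Module.support R (Ext1 (Module.End R M)ᵐᵒᵖ (M →ₗ[R] R) X R) ⊆ NG R M := by
  letI := dualModule R M R
  have main : ∀ p : PrimeSpectrum R, p ∉ NG R M →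
      p ∉ Module.support R (Ext1 (Module.End R M)ᵐᵒᵖ (M →ₗ[R] R) X R) := by
    intro p hp
    rw [NG, Module.notMem_support_iff'] at hp
    obtain ⟨r, hr, hr0⟩ := hp (Submodule.Quotient.mk 1)
    rw [← Submodule.Quotient.mk_smul, Submodule.Quotient.mk_eq_zero] at hr0
    obtain ⟨z, hz⟩ := hr0
    obtain ⟨t, rfl⟩ := Submodule.Quotient.mk_surjective _ z
    have ht : TensorProduct.lift LinearMap.applyₗ t = r := by
      simpa [evalMap] using hz
    obtain ⟨σ, hσ⟩ := exists_presentation_lift R M t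
    rw [Module.notMem_support_iff']
    refine fun q => ⟨r, hr, smul_Ext1_eq_zero
      (c := MulOpposite.op (r • (1 : Module.End R M))) (fun e => ?_) (hcentral r) σ
      (fun g => ?_) q⟩
    · apply MulOpposite.unop_injective
      simp
    · rw [hσ, ht]
      ext x
      change r • g x = g (r • x)
      simp
  exact ⟨fun p hp => Module.notMem_support_iff.mp (main p hp),
    fun p hp => by_contra fun h => main p h hp⟩
end
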